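/- Let η : ℝ×ℝ³ → ℝ³, v : ℝ×ℝ³ → ℝ³ and q : ℝ×ℝ³ → ℝ be C^∞ and satisfy the Lagrangian Euler system: ∂_tη = v, ∂_tv_α + a^{μα}∂_μq = 0, and a^{αβ}∂_αv_β = 0 at every point, where a is the cofactor matrix of ∇η and additionally a^{μα}∂_μη^β = δ^{αβ} (i.e. a = (∇η)^{-1}, equivalently det ∇η = 1). Then at every point (t,x): (i) a^{λα}∂_λ(a^{μα}∂_μq) = ∂_ta^{λα}∂_λv_α; and (ii) the Lagrangian pressure satisfies the Poisson equation Δq = ∂_λ f^λ, where f^λ = ∂_ta^{λα}v_α + (δ^{λα} − a^{λα})∂_αq + a^{λα}(δ^{μα} − a^{μα})∂_μq, with all indices summed over {1,2,3}. -/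

import Mathlib

open MeasureTheory

noncomputable section

/-- The Levi-Civita symbol `ε` on three indices (indices `0,1,2` stand for `1,2,3`). -/
def eps (i j k : Fin 3) : ℝ :=
  if (i, j, k) = ((0 : Fin 3), (1 : Fin 3), (2 : Fin 3)) ∨ (i, j, k) = (1, 2, 0) ∨
      (i, j, k) = (2, 0, 1) then 1
  else if (i, j, k) = ((0 : Fin 3), (2 : Fin 3), (1 : Fin 3)) ∨ (i, j, k) = (2, 1, 0) ∨
      (i, j, k) = (1, 0, 2) then -1
  else 0

/-- Time derivative `∂_t` of a scalar field on `ℝ × ℝ³`. -/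
def Dt (f : ℝ × (Fin 3 → ℝ) → ℝ) : ℝ × (Fin 3 → ℝ) → ℝ :=
  fun p => deriv (fun s => f (s, p.2)) p.1

/-- Spatial partial derivative `∂_μ` of a scalar field on `ℝ × ℝ³`
(`μ = 0,1,2` standing for `1,2,3`). -/
def Dx (μ : Fin 3) (f : ℝ × (Fin 3 → ℝ) → ℝ) : ℝ × (Fin 3 → ℝ) → ℝ :=
  fun p => fderiv ℝ (fun y => f (p.1, y)) p.2 (Pi.single μ 1)

/-- The cofactor matrix `a` of `∇η`: `a^{1α} = ε^{αλτ}∂₂η_λ∂₃η_τ`,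
`a^{2α} = −ε^{αλτ}∂₁η_λ∂₃η_τ`, `a^{3α} = ε^{αλτ}∂₁η_λ∂₂η_τ`. -/
def cof (η : ℝ × (Fin 3 → ℝ) → Fin 3 → ℝ) (μ α : Fin 3) : ℝ × (Fin 3 → ℝ) → ℝ :=
  fun p =>
    if μ = 0 then
      ∑ lam : Fin 3, ∑ τ : Fin 3,
        eps α lam τ * Dx 1 (fun r => η r lam) p * Dx 2 (fun r => η r τ) p
    else if μ = 1 then
      - ∑ lam : Fin 3, ∑ τ : Fin 3,
        eps α lam τ * Dx 0 (fun r => η r lam) p * Dx 2 (fun r => η r τ) p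
    else
      ∑ lam : Fin 3, ∑ τ : Fin 3,
        eps α lam τ * Dx 0 (fun r => η r lam) p * Dx 1 (fun r => η r τ) p

/-- Scalar fields on `ℝ × ℝ³`. -/
abbrev ScalarField := ℝ × (Fin 3 → ℝ) → ℝ

section Calculus

variable {f g : ScalarField}

lemma Dt_eq_fderiv (hf : ContDiff ℝ (⊤ : ℕ∞) f) : Dt f = fun p => fderiv ℝ f p (1, 0) := by
  funext p
  have h1 : HasFDerivAt f (fderiv ℝ f p) (p.1, p.2) :=
    ((hf.differentiable (by simp)) p).hasFDerivAt
  have h2 : HasDerivAt (fun s : ℝ => (s, p.2)) ((1 : ℝ), (0 : Fin 3 → ℝ)) p.1 :=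
    (hasDerivAt_id p.1).prodMk (hasDerivAt_const p.1 p.2)
  exact (h1.comp_hasDerivAt p.1 h2).deriv

lemma Dx_eq_fderiv (hf : ContDiff ℝ (⊤ : ℕ∞) f) (μ : Fin 3) :
    Dx μ f = fun p => fderiv ℝ f p (0, Pi.single μ 1) := by
  funext p
  have h1 : HasFDerivAt f (fderiv ℝ f p) (p.1, p.2) :=
    ((hf.differentiable (by simp)) p).hasFDerivAt
  have h3 := h1.comp p.2 (hasFDerivAt_prodMk_right (𝕜 := ℝ) p.1 p.2)
  have h4 := h3.fderiv
  simp only [Function.comp_def] at h4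
  simp [Dx, h4]

lemma contDiff_fderiv_apply_const (hf : ContDiff ℝ (⊤ : ℕ∞) f) (u : ℝ × (Fin 3 → ℝ)) :
    ContDiff ℝ (⊤ : ℕ∞) (fun p => fderiv ℝ f p u) :=
  (hf.fderiv_right (m := (⊤ : ℕ∞)) (by simp)).clm_apply contDiff_const

lemma ContDiff.Dt (hf : ContDiff ℝ (⊤ : ℕ∞) f) : ContDiff ℝ (⊤ : ℕ∞) (Dt f) := by
  rw [Dt_eq_fderiv hf]
  exact contDiff_fderiv_apply_const hf _

lemma ContDiff.Dx (hf : ContDiff ℝ (⊤ : ℕ∞) f) (μ : Fin 3) : ContDiff ℝ (⊤ : ℕ∞) (Dx μ f) := by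
  rw [Dx_eq_fderiv hf]
  exact contDiff_fderiv_apply_const hf _

lemma fderiv_fderiv_apply_comm (hf : ContDiff ℝ (⊤ : ℕ∞) f) (u w p : ℝ × (Fin 3 → ℝ)) :
    fderiv ℝ (fun r => fderiv ℝ f r u) p w = fderiv ℝ (fun r => fderiv ℝ f r w) p u := by
  have hd : DifferentiableAt ℝ (fderiv ℝ f) p :=
    (hf.fderiv_right (m := (⊤ : ℕ∞)) (by simp)).differentiable (by simp) p
  rw [fderiv_clm_apply hd (differentiableAt_const _),
    fderiv_clm_apply hd (differentiableAt_const _)]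
  simpa using (hf.contDiffAt.isSymmSndFDerivAt (by simpa using WithTop.coe_le_coe.2 (le_top (a := (2 : ℕ∞))))) w u

lemma Dx_Dx_comm (hf : ContDiff ℝ (⊤ : ℕ∞) f) (μ ν : Fin 3) (p : ℝ × (Fin 3 → ℝ)) :
    Dx μ (Dx ν f) p = Dx ν (Dx μ f) p := by
  rw [Dx_eq_fderiv (hf.Dx ν), Dx_eq_fderiv (hf.Dx μ), Dx_eq_fderiv hf ν, Dx_eq_fderiv hf μ]
  exact fderiv_fderiv_apply_comm hf _ _ p

lemma Dx_Dt_comm (hf : ContDiff ℝ (⊤ : ℕ∞) f) (μ : Fin 3) (p : ℝ × (Fin 3 → ℝ)) :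
    Dx μ (Dt f) p = Dt (Dx μ f) p := by
  rw [Dx_eq_fderiv hf.Dt, Dt_eq_fderiv (hf.Dx μ), Dx_eq_fderiv hf μ, Dt_eq_fderiv hf]
  exact fderiv_fderiv_apply_comm hf _ _ p

lemma Dt_add (hf : ContDiff ℝ (⊤ : ℕ∞) f) (hg : ContDiff ℝ (⊤ : ℕ∞) g)
    (p : ℝ × (Fin 3 → ℝ)) : Dt (fun r => f r + g r) p = Dt f p + Dt g p := by
  rw [Dt_eq_fderiv (hf.add hg), Dt_eq_fderiv hf, Dt_eq_fderiv hg]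
  simp [fderiv_fun_add (hf.differentiable (by simp) p) (hg.differentiable (by simp) p)]

lemma Dt_mul (hf : ContDiff ℝ (⊤ : ℕ∞) f) (hg : ContDiff ℝ (⊤ : ℕ∞) g)
    (p : ℝ × (Fin 3 → ℝ)) :
    Dt (fun r => f r * g r) p = Dt f p * g p + f p * Dt g p := by
  rw [Dt_eq_fderiv (hf.mul hg), Dt_eq_fderiv hf, Dt_eq_fderiv hg]
  simp [fderiv_fun_mul (hf.differentiable (by simp) p) (hg.differentiable (by simp) p)]
  ring

lemma Dt_sum {F : Fin 3 → ScalarField} (hF : ∀ i, ContDiff ℝ (⊤ : ℕ∞) (F i))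
    (p : ℝ × (Fin 3 → ℝ)) : Dt (fun r => ∑ i, F i r) p = ∑ i, Dt (F i) p := by
  simp only [Fin.sum_univ_three]
  rw [Dt_add ((hF 0).add (hF 1)) (hF 2), Dt_add (hF 0) (hF 1)]

lemma Dx_add (hf : ContDiff ℝ (⊤ : ℕ∞) f) (hg : ContDiff ℝ (⊤ : ℕ∞) g) (μ : Fin 3)
    (p : ℝ × (Fin 3 → ℝ)) : Dx μ (fun r => f r + g r) p = Dx μ f p + Dx μ g p := by
  rw [Dx_eq_fderiv (hf.add hg), Dx_eq_fderiv hf, Dx_eq_fderiv hg]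
  simp [fderiv_fun_add (hf.differentiable (by simp) p) (hg.differentiable (by simp) p)]

lemma Dx_mul (hf : ContDiff ℝ (⊤ : ℕ∞) f) (hg : ContDiff ℝ (⊤ : ℕ∞) g) (μ : Fin 3)
    (p : ℝ × (Fin 3 → ℝ)) :
    Dx μ (fun r => f r * g r) p = Dx μ f p * g p + f p * Dx μ g p := by
  rw [Dx_eq_fderiv (hf.mul hg), Dx_eq_fderiv hf, Dx_eq_fderiv hg]
  simp [fderiv_fun_mul (hf.differentiable (by simp) p) (hg.differentiable (by simp) p)]
  ring

lemma Dx_sum {F : Fin 3 → ScalarField} (hF : ∀ i, ContDiff ℝ (⊤ : ℕ∞) (F i)) (μ : Fin 3)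
    (p : ℝ × (Fin 3 → ℝ)) : Dx μ (fun r => ∑ i, F i r) p = ∑ i, Dx μ (F i) p := by
  simp only [Fin.sum_univ_three]
  rw [Dx_add ((hF 0).add (hF 1)) (hF 2), Dx_add (hF 0) (hF 1)]

lemma Dx_sub (hf : ContDiff ℝ (⊤ : ℕ∞) f) (hg : ContDiff ℝ (⊤ : ℕ∞) g) (μ : Fin 3)
    (p : ℝ × (Fin 3 → ℝ)) : Dx μ (fun r => f r - g r) p = Dx μ f p - Dx μ g p := by
  rw [Dx_eq_fderiv (hf.sub hg), Dx_eq_fderiv hf, Dx_eq_fderiv hg]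
  simp [fderiv_fun_sub (hf.differentiable (by simp) p) (hg.differentiable (by simp) p)]

lemma Dx_neg (μ : Fin 3) (p : ℝ × (Fin 3 → ℝ)) :
    Dx μ (fun r => - f r) p = - Dx μ f p := by
  simp [Dx]

lemma Dt_zero : Dt (fun _ => (0 : ℝ)) = fun _ => 0 := by
  funext p
  simp [Dt]

end Calculus

lemma contDiff_cof {η : ℝ × (Fin 3 → ℝ) → Fin 3 → ℝ} (hη : ContDiff ℝ (⊤ : ℕ∞) η)
    (μ α : Fin 3) : ContDiff ℝ (⊤ : ℕ∞) (cof η μ α) := by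
  have h : ∀ i j, ContDiff ℝ (⊤ : ℕ∞) (Dx i (fun r => η r j)) :=
    fun i j => (contDiff_pi.1 hη j).Dx i
  have hc : ∀ i j, ContDiff ℝ (⊤ : ℕ∞) (fun p => ∑ lam : Fin 3, ∑ τ : Fin 3,
      eps α lam τ * Dx i (fun r => η r lam) p * Dx j (fun r => η r τ) p) := fun i j =>
    ContDiff.sum fun lam _ => ContDiff.sum fun τ _ =>
      (contDiff_const.mul (h i lam)).mul (h j τ)
  unfold cof
  split_ifs
  exacts [hc 1 2, (hc 0 2).neg, hc 0 1]

/-- The `2 × 2` minor of `∇η` with derivatives `∂ᵢ, ∂ⱼ` and components `η_k, η_l`. -/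
def gradMinor (η : ℝ × (Fin 3 → ℝ) → Fin 3 → ℝ) (i j k l : Fin 3) : ScalarField :=
  fun p => Dx i (fun r => η r k) p * Dx j (fun r => η r l) p
    - Dx i (fun r => η r l) p * Dx j (fun r => η r k) p

lemma sum_eps_mul (α : Fin 3) (b c : Fin 3 → ℝ) :
    ∑ lam : Fin 3, ∑ τ : Fin 3, eps α lam τ * b lam * c τ
      = b (α + 1) * c (α + 2) - b (α + 2) * c (α + 1) := by
  fin_cases α <;> simp [Fin.sum_univ_three, eps] <;> ring

lemma cof_zero (η : ℝ × (Fin 3 → ℝ) → Fin 3 → ℝ) (α : Fin 3) :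
    cof η 0 α = gradMinor η 1 2 (α + 1) (α + 2) := by
  funext p
  simp only [cof, if_true, sum_eps_mul α (fun k => Dx 1 (fun r => η r k) p)
    (fun k => Dx 2 (fun r => η r k) p), gradMinor]

lemma cof_one (η : ℝ × (Fin 3 → ℝ) → Fin 3 → ℝ) (α : Fin 3) :
    cof η 1 α = fun p => - gradMinor η 0 2 (α + 1) (α + 2) p := by
  funext p
  simp [cof, sum_eps_mul α (fun k => Dx 0 (fun r => η r k) p)
    (fun k => Dx 2 (fun r => η r k) p), gradMinor]

lemma cof_two (η : ℝ × (Fin 3 → ℝ) → Fin 3 → ℝ) (α : Fin 3) :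
    cof η 2 α = gradMinor η 0 1 (α + 1) (α + 2) := by
  funext p
  simp [cof, sum_eps_mul α (fun k => Dx 0 (fun r => η r k) p)
    (fun k => Dx 1 (fun r => η r k) p), gradMinor]

lemma Dx_gradMinor {η : ℝ × (Fin 3 → ℝ) → Fin 3 → ℝ} (hη : ContDiff ℝ (⊤ : ℕ∞) η)
    (μ i j k l : Fin 3) (p : ℝ × (Fin 3 → ℝ)) :
    Dx μ (gradMinor η i j k l) p
      = Dx μ (Dx i (fun r => η r k)) p * Dx j (fun r => η r l) p
        + Dx i (fun r => η r k) p * Dx μ (Dx j (fun r => η r l)) p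
        - (Dx μ (Dx i (fun r => η r l)) p * Dx j (fun r => η r k) p
          + Dx i (fun r => η r l) p * Dx μ (Dx j (fun r => η r k)) p) := by
  have h : ∀ i j, ContDiff ℝ (⊤ : ℕ∞) (Dx i (fun r => η r j)) :=
    fun i j => (contDiff_pi.1 hη j).Dx i
  unfold gradMinor
  rw [Dx_sub ((h i k).mul (h j l)) ((h i l).mul (h j k)), Dx_mul (h i k) (h j l),
    Dx_mul (h i l) (h j k)]

/-- The Piola identity `∂_μ a^{μα} = 0`. -/
lemma piola_identity {η : ℝ × (Fin 3 → ℝ) → Fin 3 → ℝ} (hη : ContDiff ℝ (⊤ : ℕ∞) η)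
    (α : Fin 3) (p : ℝ × (Fin 3 → ℝ)) : ∑ μ : Fin 3, Dx μ (cof η μ α) p = 0 := by
  have hc : ∀ i j k, Dx i (Dx j (fun r => η r k)) p = Dx j (Dx i (fun r => η r k)) p :=
    fun i j k => Dx_Dx_comm (contDiff_pi.1 hη k) i j p
  rw [Fin.sum_univ_three, cof_zero, cof_one, cof_two, Dx_neg]
  simp only [Dx_gradMinor hη]
  rw [hc 1 0, hc 1 0, hc 2 0, hc 2 0, hc 2 1, hc 2 1]
  ring

/-- If `∂_λ b^{λα} = 0` at a point, then `∂_λ(b^{λα} w_α) = b^{λα} ∂_λ w_α` there. -/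
lemma sum_Dx_mul_of_divergence_free {b : Fin 3 → Fin 3 → ScalarField} {w : Fin 3 → ScalarField}
    (hb : ∀ i j, ContDiff ℝ (⊤ : ℕ∞) (b i j)) (hw : ∀ i, ContDiff ℝ (⊤ : ℕ∞) (w i))
    {p : ℝ × (Fin 3 → ℝ)} (hdiv : ∀ j, ∑ i, Dx i (b i j) p = 0) :
    ∑ i, Dx i (fun r => ∑ j, b i j r * w j r) p = ∑ i, ∑ j, b i j p * Dx i (w j) p := by
  have h : ∀ i, Dx i (fun r => ∑ j, b i j r * w j r) p
      = ∑ j, Dx i (b i j) p * w j p + ∑ j, b i j p * Dx i (w j) p := fun i => by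
    rw [Dx_sum (fun j => (hb i j).mul (hw j)), ← Finset.sum_add_distrib]
    exact Finset.sum_congr rfl fun j _ => Dx_mul (hb i j) (hw j) i p
  simp_rw [h]
  rw [Finset.sum_add_distrib, Finset.sum_comm]
  simp_rw [← Finset.sum_mul, hdiv]
  simp

/-- The Lagrangian pressure satisfies `a^{λα}∂_λ(a^{μα}∂_μq) = ∂_ta^{λα}∂_λv_α` and hence
the Poisson equation `Δq = ∂_λ f^λ` with
`f^λ = ∂_ta^{λα}v_α + (δ^{λα} − a^{λα})∂_αq + a^{λα}(δ^{μα} − a^{μα})∂_μq`. -/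
theorem pressure_poisson
    (η v : ℝ × (Fin 3 → ℝ) → Fin 3 → ℝ) (q : ℝ × (Fin 3 → ℝ) → ℝ)
    (hη : ContDiff ℝ (⊤ : ℕ∞) η) (hv : ContDiff ℝ (⊤ : ℕ∞) v) (hq : ContDiff ℝ (⊤ : ℕ∞) q)
    (a : Fin 3 → Fin 3 → ℝ × (Fin 3 → ℝ) → ℝ) (ha : ∀ μ α, a μ α = cof η μ α)
    (hflow : ∀ (p : ℝ × (Fin 3 → ℝ)) (α : Fin 3), Dt (fun r => η r α) p = v p α)
    (heuler : ∀ (p : ℝ × (Fin 3 → ℝ)) (α : Fin 3),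
      Dt (fun r => v r α) p + ∑ μ : Fin 3, a μ α p * Dx μ q p = 0)
    (hdiv : ∀ p : ℝ × (Fin 3 → ℝ),
      ∑ α : Fin 3, ∑ β : Fin 3, a α β p * Dx α (fun r => v r β) p = 0)
    (hinv : ∀ (p : ℝ × (Fin 3 → ℝ)) (α β : Fin 3),
      ∑ μ : Fin 3, a μ α p * Dx μ (fun r => η r β) p = if α = β then 1 else 0) :
    ∀ p : ℝ × (Fin 3 → ℝ),
      (∑ lam : Fin 3, ∑ α : Fin 3,
          a lam α p * Dx lam (fun r => ∑ μ : Fin 3, a μ α r * Dx μ q r) p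
        = ∑ lam : Fin 3, ∑ α : Fin 3, Dt (a lam α) p * Dx lam (fun r => v r α) p)
      ∧ (∑ lam : Fin 3, Dx lam (Dx lam q) p
        = ∑ lam : Fin 3, Dx lam (fun r => ∑ α : Fin 3,
            (Dt (a lam α) r * v r α
              + ((if lam = α then (1 : ℝ) else 0) - a lam α r) * Dx α q r
              + a lam α r * ∑ μ : Fin 3,
                  ((if μ = α then (1 : ℝ) else 0) - a μ α r) * Dx μ q r)) p) := by
  obtain rfl : a = cof η := funext fun μ => funext fun α => ha μ α
  have hA := contDiff_cof hη
  have hV : ∀ α, ContDiff ℝ (⊤ : ℕ∞) (fun r => v r α) := contDiff_pi.1 hv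
  have hG : ∀ α, ContDiff ℝ (⊤ : ℕ∞) (fun r => ∑ μ : Fin 3, cof η μ α r * Dx μ q r) :=
    fun α => ContDiff.sum fun μ _ => (hA μ α).mul (hq.Dx μ)
  have hacc : ∀ α, (fun r => ∑ μ : Fin 3, cof η μ α r * Dx μ q r)
      = fun r => - Dt (fun r => v r α) r :=
    fun α => funext fun r => by linarith [heuler r α]
  intro p
  have hi : ∑ lam : Fin 3, ∑ α : Fin 3,
        cof η lam α p * Dx lam (fun r => ∑ μ : Fin 3, cof η μ α r * Dx μ q r) p
      = ∑ lam : Fin 3, ∑ α : Fin 3, Dt (cof η lam α) p * Dx lam (fun r => v r α) p := by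
    have hdt := congrFun (congrArg Dt (funext hdiv)) p
    rw [Dt_zero, Dt_sum fun i => ContDiff.sum fun j _ => (hA i j).mul ((hV j).Dx i)] at hdt
    simp_rw [Dt_sum fun j => (hA _ j).mul ((hV j).Dx _), Dt_mul (hA _ _) ((hV _).Dx _),
      ← Dx_Dt_comm (hV _), Finset.sum_add_distrib] at hdt
    simp_rw [hacc, Dx_neg, mul_neg, Finset.sum_neg_distrib]
    linarith
  refine ⟨hi, ?_⟩
  have hpiola : ∀ α, ∑ lam, Dx lam (cof η lam α) p = 0 := fun α => piola_identity hη α p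
  have hpiolat : ∀ α, ∑ lam, Dx lam (Dt (cof η lam α)) p = 0 := fun α => by
    have h := congrFun (congrArg Dt (funext (piola_identity hη α))) p
    rw [Dt_zero, Dt_sum fun i => (hA i α).Dx i] at h
    simpa only [Dx_Dt_comm (hA _ α)] using h
  have hflux : ∀ lam, (fun r => ∑ α : Fin 3,
      (Dt (cof η lam α) r * v r α
        + ((if lam = α then (1 : ℝ) else 0) - cof η lam α r) * Dx α q r
        + cof η lam α r * ∑ μ : Fin 3,
            ((if μ = α then (1 : ℝ) else 0) - cof η μ α r) * Dx μ q r))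
      = fun r => (∑ α, Dt (cof η lam α) r * v r α + Dx lam q r)
          - ∑ α, cof η lam α r * ∑ μ, cof η μ α r * Dx μ q r := fun lam => by
    funext r
    simp only [sub_mul, ite_mul, one_mul, zero_mul, Finset.sum_add_distrib,
      Finset.sum_sub_distrib, mul_sub, Finset.sum_ite_eq, Finset.sum_ite_eq',
      Finset.mem_univ, if_true]
    ring
  have hF : ∀ lam, ContDiff ℝ (⊤ : ℕ∞) (fun r => ∑ α, Dt (cof η lam α) r * v r α) :=
    fun lam => ContDiff.sum fun α _ => (hA lam α).Dt.mul (hV α)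
  have hH : ∀ lam, ContDiff ℝ (⊤ : ℕ∞)
      (fun r => ∑ α, cof η lam α r * ∑ μ, cof η μ α r * Dx μ q r) :=
    fun lam => ContDiff.sum fun α _ => (hA lam α).mul (hG α)
  simp_rw [hflux, Dx_sub ((hF _).add (hq.Dx _)) (hH _), Dx_add (hF _) (hq.Dx _),
    Finset.sum_sub_distrib, Finset.sum_add_distrib]
  rw [sum_Dx_mul_of_divergence_free (fun i j => (hA i j).Dt) hV hpiolat,
    sum_Dx_mul_of_divergence_free hA hG hpiola, hi]
  ring
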